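/- arXiv:2605.04151 — 2 statements merged into one kernel-verified Lean document; each statement's English description precedes it below -/
import Mathlib

section
/- Let R be the Laurent polynomial ring in two variables over F₂ with involutions bar, σ, ρ as below. Let f₁ be a unit of R, let g₁, h₁ ∈ R satisfy bar(g₁)·σ(h₁) + bar(h₁)·σ(g₁) = 0, and set u = g₁·f₁⁻¹, v = h₁·f₁⁻¹. Define the 6×6 matrices over R: U₁ = block diagonal with upper-left 3×3 block [[1,0,0],[u,1,0],[v,0,1]] and lower-right 3×3 block [[1, bar(u), bar(v)],[0,1,0],[0,0,1]]; and U₂ = block diagonal with upper-left 3×3 block [[1, ρ(v), ρ(u)],[0,1,0],[0,0,1]] and lower-right 3×3 block [[1,0,0],[σ(v),1,0],[σ(u),0,1]]. Then U := U₂·U₁ satisfies U·(f₁, g₁, h₁, 0, 0, 0)ᵀ = (f₁, 0, 0, 0, 0, 0)ᵀ and U·(0, 0, 0, σ(f₁), σ(h₁), σ(g₁))ᵀ = (0, 0, 0, σ(f₁), 0, 0)ᵀ. -/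
open Matrix

noncomputable section

set_option synthInstance.maxHeartbeats 1000000
set_option maxHeartbeats 1000000

/-- `R = F₂[x^{±1}, y^{±1}]`, the Laurent polynomial ring in two variables over the field
with two elements, realized as the monoid algebra of the additive group `ℤ × ℤ` over `ZMod 2`. -/
abbrev LaurentF2 : Type := AddMonoidAlgebra (ZMod 2) (ℤ × ℤ)

/-- The antipode automorphism `bar`, induced by the group automorphism `(a,b) ↦ (-a,-b)`. -/
def barR : LaurentF2 ≃ₐ[ZMod 2] LaurentF2 :=
  AddMonoidAlgebra.domCongr (ZMod 2) (ZMod 2) (AddEquiv.neg (ℤ × ℤ))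

/-- The automorphism `σ`, induced by the group automorphism `(a,b) ↦ (b,a)`. -/
def sigR : LaurentF2 ≃ₐ[ZMod 2] LaurentF2 :=
  AddMonoidAlgebra.domCongr (ZMod 2) (ZMod 2) (AddEquiv.prodComm : ℤ × ℤ ≃+ ℤ × ℤ)

/-- The automorphism `ρ`, induced by the group automorphism `(a,b) ↦ (-b,-a)`. -/
def rhoR : LaurentF2 ≃ₐ[ZMod 2] LaurentF2 :=
  AddMonoidAlgebra.domCongr (ZMod 2) (ZMod 2)
    ((AddEquiv.prodComm : ℤ × ℤ ≃+ ℤ × ℤ).trans (AddEquiv.neg (ℤ × ℤ)))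

/-- The monomial `x`, of exponent `(1, 0)`. -/
def xGen : LaurentF2 := AddMonoidAlgebra.single ((1 : ℤ), (0 : ℤ)) 1

/-- The monomial `y`, of exponent `(0, 1)`. -/
def yGen : LaurentF2 := AddMonoidAlgebra.single ((0 : ℤ), (1 : ℤ)) 1

theorem LaurentF2.add_self (a : LaurentF2) : a + a = 0 := by
  rw [← two_smul (ZMod 2) a, show (2 : ZMod 2) = 0 from rfl, zero_smul]

/-- Explicit Clifford reduction in the direct sector: with `f₁` a unit,
`bar(g₁)·σ(h₁) + bar(h₁)·σ(g₁) = 0`, `u = g₁·f₁⁻¹`, `v = h₁·f₁⁻¹`, the two CNOT layers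
`U₁`, `U₂` satisfy `U₂·U₁·(f₁,g₁,h₁,0,0,0)ᵀ = (f₁,0,0,0,0,0)ᵀ` and
`U₂·U₁·(0,0,0,σf₁,σh₁,σg₁)ᵀ = (0,0,0,σf₁,0,0)ᵀ`. -/
theorem explicit_clifford_reduction
    (f₁ g₁ h₁ : LaurentF2) (hf : IsUnit f₁)
    (hrel : barR g₁ * sigR h₁ + barR h₁ * sigR g₁ = 0)
    (u v : LaurentF2)
    (hu : u = g₁ * Ring.inverse f₁) (hv : v = h₁ * Ring.inverse f₁)
    (U₁ U₂ : Matrix (Fin 6) (Fin 6) LaurentF2)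
    (hU₁ : U₁ = !![1, 0, 0, 0, 0, 0;
                   u, 1, 0, 0, 0, 0;
                   v, 0, 1, 0, 0, 0;
                   0, 0, 0, 1, barR u, barR v;
                   0, 0, 0, 0, 1, 0;
                   0, 0, 0, 0, 0, 1])
    (hU₂ : U₂ = !![1, rhoR v, rhoR u, 0, 0, 0;
                   0, 1, 0, 0, 0, 0;
                   0, 0, 1, 0, 0, 0;
                   0, 0, 0, 1, 0, 0;
                   0, 0, 0, sigR v, 1, 0;
                   0, 0, 0, sigR u, 0, 1]) :
    (U₂ * U₁).mulVec ![f₁, g₁, h₁, 0, 0, 0] = ![f₁, 0, 0, 0, 0, 0] ∧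
    (U₂ * U₁).mulVec ![0, 0, 0, sigR f₁, sigR h₁, sigR g₁] =
      ![0, 0, 0, sigR f₁, 0, 0] := by
  have hinv : Ring.inverse f₁ * f₁ = 1 := Ring.inverse_mul_cancel f₁ hf
  have huf : u * f₁ = g₁ := by rw [hu, mul_assoc, hinv, mul_one]
  have hvf : v * f₁ = h₁ := by rw [hv, mul_assoc, hinv, mul_one]
  have hsu : sigR u * sigR f₁ = sigR g₁ := by rw [← map_mul, huf]
  have hsv : sigR v * sigR f₁ = sigR h₁ := by rw [← map_mul, hvf]
  have hbar : barR u * sigR h₁ + barR v * sigR g₁ = 0 := by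
    rw [hu, hv, map_mul, map_mul]
    linear_combination barR (Ring.inverse f₁) * hrel
  have hX : U₁ *ᵥ ![f₁, g₁, h₁, 0, 0, 0] = ![f₁, 0, 0, 0, 0, 0] := by
    rw [hU₁]
    ext1 i
    fin_cases i <;>
      simp [Matrix.mulVec, dotProduct, Fin.sum_univ_succ, huf, hvf, LaurentF2.add_self]
  have hZ : U₁ *ᵥ ![0, 0, 0, sigR f₁, sigR h₁, sigR g₁] =
      ![0, 0, 0, sigR f₁, sigR h₁, sigR g₁] := by
    rw [hU₁]
    ext1 i
    fin_cases i <;> simp [Matrix.mulVec, dotProduct, Fin.sum_univ_succ, hbar]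
  rw [← Matrix.mulVec_mulVec, ← Matrix.mulVec_mulVec, hX, hZ, hU₂]
  constructor <;> ext1 i <;> fin_cases i <;>
    simp [Matrix.mulVec, dotProduct, Fin.sum_univ_succ, hsu, hsv, LaurentF2.add_self]
end
end

section
/- Let R be the Laurent polynomial ring in two variables over F₂, let bar be its antipode automorphism, and let Λ be the 6×6 block matrix [[0, I₃],[I₃, 0]] over R. Let x = (x₁,x₂,x₃) and z = (z₁,z₂,z₃) be vectors in R³ with bar(x₁)·z₁ + bar(x₂)·z₂ + bar(x₃)·z₃ = 1. Then there exists an invertible 6×6 matrix U over R which is symplectic with respect to Λ and the antipode, i.e., (entrywise bar of U)ᵀ · Λ · U = Λ, such that U·(x₁,x₂,x₃,0,0,0)ᵀ = (1,0,0,0,0,0)ᵀ and U·(0,0,0,z₁,z₂,z₃)ᵀ = (0,0,0,1,0,0)ᵀ. -/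
open Matrix

noncomputable section

set_option synthInstance.maxHeartbeats 1000000
set_option maxHeartbeats 1000000

/-- The standard symplectic form `Λ = [[0, I₃],[I₃, 0]]` on `R^6` (over `F₂`, `-I₃ = I₃`). -/
def Lam : Matrix (Fin 6) (Fin 6) LaurentF2 :=
  Matrix.of fun i j => if (i : ℕ) + 3 = (j : ℕ) ∨ (j : ℕ) + 3 = (i : ℕ) then 1 else 0

/-- A localization of a principal ideal ring is a principal ideal ring. -/
theorem IsLocalization.isPrincipalIdealRing_of_isLocalization {A : Type*} [CommRing A]
    [IsPrincipalIdealRing A] (S : Submonoid A) (B : Type*) [CommRing B] [Algebra A B]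
    [IsLocalization S B] : IsPrincipalIdealRing B where
  principal I := by
    obtain ⟨a, ha⟩ := (IsPrincipalIdealRing.principal (I.under A)).principal
    refine ⟨algebraMap A B a, ?_⟩
    rw [← IsLocalization.map_under S B I, ha]
    simp only [Ideal.submodule_span_eq, Ideal.map_span, Set.image_singleton]

instance LaurentPolynomial.isPrincipalIdealRing {k : Type*} [Field k] :
    IsPrincipalIdealRing (LaurentPolynomial k) :=
  IsLocalization.isPrincipalIdealRing_of_isLocalization
    (Submonoid.powers (Polynomial.X : Polynomial k)) _

/-- Every pair over `E` is a multiple of the image of the first row of a matrix in `SL₂(R)`. -/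
def RingHom.LiftsPairs {R E : Type*} [CommRing R] [CommRing E] (φ : R →+* E) : Prop :=
  ∀ a b : E, ∃ (α β γ δ : R) (d : E), α * δ - β * γ = 1 ∧ a = d * φ α ∧ b = d * φ β

theorem RingHom.liftsPairs_of_euclideanDomain {R E : Type*} [CommRing R] [EuclideanDomain E]
    (φ : R →+* E) (hφ : Function.Surjective φ) : φ.LiftsPairs := by
  intro a b
  induction a, b using EuclideanDomain.GCD.induction with
  | H0 b => exact ⟨0, 1, -1, 0, b, by ring, by simp, by simp⟩
  | H1 a b _ ih =>
    obtain ⟨α, β, γ, δ, d, hdet, h₁, h₂⟩ := ih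
    obtain ⟨q, hq⟩ := hφ (b / a)
    refine ⟨β, α + β * q, -δ, -γ - δ * q, d, by linear_combination hdet, h₂, ?_⟩
    have hdiv := EuclideanDomain.div_add_mod b a
    rw [map_add, map_mul, hq]
    linear_combination -hdiv + h₁ + (b / a) * h₂

theorem LaurentPolynomial.mapRingHom_toLaurent {A k : Type*} [CommRing A] [CommRing k]
    (f : A →+* k) (p : Polynomial A) :
    AddMonoidAlgebra.mapRingHom ℤ f (Polynomial.toLaurent p) =
      Polynomial.toLaurent (p.map f) := by
  induction p using Polynomial.induction_on' with
  | add p q hp hq => rw [Polynomial.map_add, map_add, map_add, map_add, hp, hq]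
  | monomial n a =>
    rw [Polynomial.map_monomial, ← Polynomial.C_mul_X_pow_eq_monomial,
      ← Polynomial.C_mul_X_pow_eq_monomial, Polynomial.toLaurent_C_mul_X_pow,
      Polynomial.toLaurent_C_mul_X_pow, ← LaurentPolynomial.single_eq_C_mul_T,
      ← LaurentPolynomial.single_eq_C_mul_T, AddMonoidAlgebra.mapRingHom_single]

theorem LaurentPolynomial.liftsPairs_mapRingHom {A k : Type*} [CommRing A] [Field k]
    (f : A →+* k) (hf : Function.Surjective f) :
    RingHom.LiftsPairs (R := LaurentPolynomial A) (E := LaurentPolynomial k)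
      (AddMonoidAlgebra.mapRingHom ℤ f) := by
  intro a b
  obtain ⟨m, p, hp⟩ := LaurentPolynomial.exists_T_pow a
  obtain ⟨n, q, hq⟩ := LaurentPolynomial.exists_T_pow b
  obtain ⟨α, β, γ, δ, d, hdet, h₁, h₂⟩ :=
    (Polynomial.mapRingHom f).liftsPairs_of_euclideanDomain (Polynomial.map_surjective f hf)
      (p * Polynomial.X ^ n) (q * Polynomial.X ^ m)
  have hT : (LaurentPolynomial.T m * LaurentPolynomial.T n * LaurentPolynomial.T (-m - n) :
      LaurentPolynomial k) = 1 := by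
    rw [← LaurentPolynomial.T_add, ← LaurentPolynomial.T_add, ← LaurentPolynomial.T_zero]
    congr 1
    ring
  refine ⟨Polynomial.toLaurent α, Polynomial.toLaurent β, Polynomial.toLaurent γ,
    Polynomial.toLaurent δ, Polynomial.toLaurent d * LaurentPolynomial.T (-m - n),
    by simp only [← map_mul, ← map_sub, hdet, map_one], ?_, ?_⟩
  · have h := congrArg Polynomial.toLaurent h₁
    rw [Polynomial.coe_mapRingHom, map_mul, map_mul, hp, Polynomial.toLaurent_X_pow] at h
    rw [LaurentPolynomial.mapRingHom_toLaurent]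
    linear_combination (LaurentPolynomial.T (-m - n)) * h - a * hT
  · have h := congrArg Polynomial.toLaurent h₂
    rw [Polynomial.coe_mapRingHom, map_mul, map_mul, hq, Polynomial.toLaurent_X_pow] at h
    rw [LaurentPolynomial.mapRingHom_toLaurent]
    linear_combination (LaurentPolynomial.T (-m - n)) * h - b * hT

/-- If `E` is `R / p` and `p` divides the determinant of a matrix with unimodular first row `v`,
then one factor `p` can be removed from the determinant without changing `v`. -/
theorem RingHom.LiftsPairs.exists_det_eq_mul {R E : Type*} [CommRing R] [CommRing E] [IsDomain E]
    {φ : R →+* E} (hφ : φ.LiftsPairs) {p : R} (hp : ∀ r, φ r = 0 → p ∣ r) (hp' : φ p = 0)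
    {v w : Fin 3 → R} (hvw : w ⬝ᵥ v = 1) {a b : Fin 3 → R} {r : R}
    (hdet : (Matrix.of ![v, a, b]).det = p * r) :
    ∃ a' b' : Fin 3 → R, p * (Matrix.of ![v, a', b']).det = p * r := by
  obtain ⟨c, hc, hcM⟩ := Matrix.exists_vecMul_eq_zero_iff.2
    (show ((Matrix.of ![v, a, b]).map φ).det = 0 by
      rw [← RingHom.mapMatrix_apply, ← RingHom.map_det, hdet, map_mul, hp', zero_mul])
  obtain ⟨α, β, γ, δ, d, hαδ, h₁, h₂⟩ := hφ (c 1) (c 2)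
  have hrel (i : Fin 3) : c 0 * φ (v i) + d * φ (α * a i + β * b i) = 0 := by
    have := congrFun hcM i
    simp only [Matrix.vecMul, dotProduct, Fin.sum_univ_three, Matrix.map_apply, Matrix.of_apply,
      Matrix.cons_val, Pi.zero_apply] at this
    simp only [map_add, map_mul]
    linear_combination this - φ (a i) * h₁ - φ (b i) * h₂
  have hvwφ := congrArg φ hvw
  simp only [dotProduct, Fin.sum_univ_three, map_add, map_mul, map_one] at hvwφ
  set s : R := w ⬝ᵥ fun i => α * a i + β * b i with hs
  have hsφ := congrArg φ hs
  simp only [dotProduct, Fin.sum_univ_three, map_add, map_mul] at hsφ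
  have hc0 : c 0 = -(d * φ s) := by
    have e0 := hrel 0
    have e1 := hrel 1
    have e2 := hrel 2
    simp only [map_add, map_mul] at e0 e1 e2
    linear_combination φ (w 0) * e0 + φ (w 1) * e1 + φ (w 2) * e2 - c 0 * hvwφ + d * hsφ
  have hd : d ≠ 0 := by
    rintro rfl
    apply hc
    ext i
    fin_cases i <;> simp [hc0, h₁, h₂]
  have hdvd (i : Fin 3) : p ∣ α * a i + β * b i - s * v i := by
    refine hp _ (mul_left_cancel₀ hd ?_)
    rw [map_sub, map_mul φ s]
    linear_combination hrel i - φ (v i) * hc0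
  choose a' ha' using hdvd
  refine ⟨a', fun i => γ * a i + δ * b i, ?_⟩
  rw [← hdet]
  simp only [Matrix.det_fin_three, Matrix.of_apply, Matrix.cons_val]
  have k0 := ha' 0
  have k1 := ha' 1
  have k2 := ha' 2
  linear_combination (v 1 * (γ * a 2 + δ * b 2) - v 2 * (γ * a 1 + δ * b 1)) * k0
    - (v 0 * (γ * a 2 + δ * b 2) - v 2 * (γ * a 0 + δ * b 0)) * k1
    + (v 0 * (γ * a 1 + δ * b 1) - v 1 * (γ * a 0 + δ * b 0)) * k2
    + (v 0 * a 1 * b 2 - v 0 * a 2 * b 1 - v 1 * a 0 * b 2 + v 1 * a 2 * b 0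
      + v 2 * a 0 * b 1 - v 2 * a 1 * b 0) * hαδ

/-- Over a ring where pairs are multiples of first rows of `SL₂`, unimodular rows of length three
are completable. -/
theorem RingHom.LiftsPairs.exists_det_eq_one {R : Type*} [CommRing R]
    (hR : (RingHom.id R).LiftsPairs) {v w : Fin 3 → R} (hvw : w ⬝ᵥ v = 1) :
    ∃ a b : Fin 3 → R, (Matrix.of ![v, a, b]).det = 1 := by
  obtain ⟨α, β, γ, δ, g, hdet, h₁, h₂⟩ := hR (v 1) (v 2)
  obtain ⟨α', β', γ', δ', d, hdet', h₀, hg⟩ := hR (v 0) g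
  simp only [RingHom.id_apply] at h₁ h₂ h₀ hg
  simp only [dotProduct, Fin.sum_univ_three] at hvw
  refine ⟨(w 0 * α' + w 1 * (β' * α) + w 2 * (β' * β)) • ![γ', δ' * α, δ' * β], ![0, γ, δ], ?_⟩
  have hv : v = d • ![α', β' * α, β' * β] := by
    ext i
    fin_cases i
    · simpa using h₀
    · simp [h₁, hg, mul_assoc]
    · simp [h₂, hg, mul_assoc]
  subst hv
  simp only [Matrix.det_fin_three, Matrix.of_apply, Matrix.cons_val, Pi.smul_apply,
    smul_eq_mul] at hvw ⊢
  linear_combination hvw + d * (w 0 * α' + w 1 * (β' * α) + w 2 * (β' * β)) *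
    ((α * δ - β * γ) * hdet' + hdet)

theorem LaurentPolynomial.C_dvd_of_forall_dvd_coeff {A : Type*} [CommRing A] {p : A}
    {r : LaurentPolynomial A} (h : ∀ n, p ∣ r.coeff n) : LaurentPolynomial.C p ∣ r := by
  choose q hq using h
  rw [← AddMonoidAlgebra.sum_coeff_single r]
  refine Finset.dvd_sum fun n _ => ⟨AddMonoidAlgebra.single n (q n), ?_⟩
  rw [hq n, ← LaurentPolynomial.single_eq_C, AddMonoidAlgebra.single_mul_single, zero_add]

theorem LaurentPolynomial.mapRingHom_C {A k : Type*} [CommRing A] [CommRing k]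
    (f : A →+* k) (a : A) :
    AddMonoidAlgebra.mapRingHom ℤ f (LaurentPolynomial.C a) = LaurentPolynomial.C (f a) :=
  AddMonoidAlgebra.mapRingHom_single ..

theorem LaurentPolynomial.exists_C_mul_eq_map {A K : Type*} [CommRing A] [IsDomain A] [Field K]
    [Algebra A K] [IsFractionRing A K] (f : LaurentPolynomial K) :
    ∃ s : A, s ≠ 0 ∧ ∃ g : LaurentPolynomial A,
      AddMonoidAlgebra.mapRingHom ℤ (algebraMap A K) g =
        LaurentPolynomial.C (algebraMap A K s) * f := by
  induction f using LaurentPolynomial.induction_on' with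
  | add f g hf hg =>
    obtain ⟨s, hs, f', hf'⟩ := hf
    obtain ⟨t, ht, g', hg'⟩ := hg
    refine ⟨s * t, mul_ne_zero hs ht, LaurentPolynomial.C t * f' + LaurentPolynomial.C s * g', ?_⟩
    rw [map_add, map_mul, map_mul, LaurentPolynomial.mapRingHom_C,
      LaurentPolynomial.mapRingHom_C, hf', hg', map_mul, map_mul]
    ring
  | C_mul_T n a =>
    obtain ⟨⟨r, s⟩, h⟩ := IsLocalization.surj (nonZeroDivisors A) a
    refine ⟨s, nonZeroDivisors.ne_zero s.2, AddMonoidAlgebra.single n r, ?_⟩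
    rw [AddMonoidAlgebra.mapRingHom_single, ← mul_assoc, ← map_mul, mul_comm _ a, h,
      LaurentPolynomial.single_eq_C_mul_T]

/-- A common denominator for finitely many Laurent polynomials over a fraction field. -/
theorem LaurentPolynomial.exists_C_smul_eq_map {A K ι : Type*} [CommRing A] [IsDomain A] [Field K]
    [Algebra A K] [IsFractionRing A K] [Fintype ι] (f : ι → LaurentPolynomial K) :
    ∃ s : A, s ≠ 0 ∧ ∃ g : ι → LaurentPolynomial A, ∀ i,
      AddMonoidAlgebra.mapRingHom ℤ (algebraMap A K) (g i) =
        LaurentPolynomial.C (algebraMap A K s) * f i := by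
  classical
  choose s hs g hg using fun i => LaurentPolynomial.exists_C_mul_eq_map (A := A) (f i)
  refine ⟨∏ i, s i, Finset.prod_ne_zero_iff.2 fun i _ => hs i,
    fun i => LaurentPolynomial.C (∏ j ∈ Finset.univ.erase i, s j) * g i, fun i => ?_⟩
  rw [map_mul, hg, LaurentPolynomial.mapRingHom_C,
    ← Finset.prod_erase_mul Finset.univ s (Finset.mem_univ i), map_mul, map_mul, mul_assoc]

/-- Unimodular rows of length three over the Laurent polynomials over a principal ideal domain
can be completed to an invertible matrix. -/
theorem LaurentPolynomial.exists_isUnit_det {A : Type*} [CommRing A] [IsDomain A]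
    [IsPrincipalIdealRing A] {v w : Fin 3 → LaurentPolynomial A} (hvw : w ⬝ᵥ v = 1) :
    ∃ a b : Fin 3 → LaurentPolynomial A, IsUnit (Matrix.of ![v, a, b]).det := by
  have descent (d : A) : d ≠ 0 → (∃ a b : Fin 3 → LaurentPolynomial A,
      (Matrix.of ![v, a, b]).det = LaurentPolynomial.C d) →
      ∃ a b : Fin 3 → LaurentPolynomial A, IsUnit (Matrix.of ![v, a, b]).det := by
    induction d using UniqueFactorizationMonoid.induction_on_prime with
    | h₁ => exact fun h => absurd rfl h
    | h₂ d hd =>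
      rintro - ⟨a, b, hab⟩
      exact ⟨a, b, hab ▸ hd.map LaurentPolynomial.C⟩
    | h₃ d p hd hp ih =>
      rintro - ⟨a, b, hab⟩
      refine ih hd ?_
      have : (Ideal.span {p}).IsMaximal :=
        PrincipalIdealRing.isMaximal_of_irreducible hp.irreducible
      let := Ideal.Quotient.field (Ideal.span {p})
      rw [map_mul] at hab
      have hdvd (r : LaurentPolynomial A)
          (hr : AddMonoidAlgebra.mapRingHom ℤ (Ideal.Quotient.mk (Ideal.span {p})) r = 0) :
          LaurentPolynomial.C p ∣ r := by
        refine LaurentPolynomial.C_dvd_of_forall_dvd_coeff fun n => ?_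
        have := congrArg (fun f : LaurentPolynomial (A ⧸ Ideal.span {p}) => f.coeff n) hr
        simpa [Ideal.Quotient.eq_zero_iff_dvd] using this
      obtain ⟨a', b', h⟩ := (LaurentPolynomial.liftsPairs_mapRingHom
        (Ideal.Quotient.mk (Ideal.span {p})) Ideal.Quotient.mk_surjective).exists_det_eq_mul
        hdvd
        (by rw [LaurentPolynomial.mapRingHom_C, Ideal.Quotient.mk_singleton_self, map_zero])
        hvw hab
      refine ⟨a', b', mul_left_cancel₀ (fun h0 => hp.ne_zero ?_) h⟩
      simpa using congrArg (fun f : LaurentPolynomial A => f.coeff 0) h0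
  let K := FractionRing A
  let ψ : LaurentPolynomial A →+* LaurentPolynomial K :=
    AddMonoidAlgebra.mapRingHom ℤ (algebraMap A K)
  have hψ : Function.Injective ψ := fun f g hfg => by
    ext n
    have := congrArg (fun f : LaurentPolynomial K => f.coeff n) hfg
    simpa [ψ] using this
  have hid := LaurentPolynomial.liftsPairs_mapRingHom (RingHom.id K) Function.surjective_id
  rw [AddMonoidAlgebra.mapRingHom_id] at hid
  obtain ⟨a, b, hab⟩ := RingHom.LiftsPairs.exists_det_eq_one hid (v := ψ ∘ v) (w := ψ ∘ w) (by
    rw [← RingHom.map_dotProduct, hvw, map_one])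
  obtain ⟨s, hs, a', ha'⟩ := LaurentPolynomial.exists_C_smul_eq_map (A := A) a
  obtain ⟨t, ht, b', hb'⟩ := LaurentPolynomial.exists_C_smul_eq_map (A := A) b
  refine descent (s * t) (mul_ne_zero hs ht) ⟨a', b', hψ ?_⟩
  have hst : ψ (LaurentPolynomial.C (s * t)) = LaurentPolynomial.C (algebraMap A K s) *
      LaurentPolynomial.C (algebraMap A K t) := by
    rw [← map_mul, ← map_mul]
    exact LaurentPolynomial.mapRingHom_C ..
  change ∀ i, ψ (a' i) = _ at ha'
  change ∀ i, ψ (b' i) = _ at hb'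
  rw [hst]
  simp only [Matrix.det_fin_three, Matrix.of_apply, Matrix.cons_val, Function.comp_apply] at hab ⊢
  simp only [map_add, map_sub, map_mul, ha', hb']
  linear_combination LaurentPolynomial.C (algebraMap A K s) *
      LaurentPolynomial.C (algebraMap A K t) * hab

/-- A pair of vectors with pairing one over the Laurent polynomials over a principal ideal domain
is the first row and the first column of two mutually inverse matrices. -/
theorem LaurentPolynomial.exists_mul_eq_one {A : Type*} [CommRing A] [IsDomain A]
    [IsPrincipalIdealRing A] {v w : Fin 3 → LaurentPolynomial A} (hvw : w ⬝ᵥ v = 1) :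
    ∃ P Q : Matrix (Fin 3) (Fin 3) (LaurentPolynomial A), P * Q = 1 ∧
      (∀ i, P 0 i = v i) ∧ ∀ i, Q i 0 = w i := by
  obtain ⟨a, b, hab⟩ := LaurentPolynomial.exists_isUnit_det hvw
  set M := Matrix.of ![v, a, b] with hM
  have hMw : (M *ᵥ w) 0 = 1 := by
    rw [← hvw, dotProduct_comm]
    rfl
  let N : Matrix (Fin 3) (Fin 3) (LaurentPolynomial A) :=
    !![1, 0, 0; (M *ᵥ w) 1, 1, 0; (M *ᵥ w) 2, 0, 1]
  let N' : Matrix (Fin 3) (Fin 3) (LaurentPolynomial A) :=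
    !![1, 0, 0; -(M *ᵥ w) 1, 1, 0; -(M *ᵥ w) 2, 0, 1]
  have hN : N' * N = 1 := by
    ext i j
    fin_cases i <;> fin_cases j <;> simp [N, N', Matrix.mul_apply, Fin.sum_univ_three]
  have hN0 : N.col 0 = M *ᵥ w := by
    ext i
    fin_cases i <;> simp [N, hMw]
  refine ⟨N' * M, M⁻¹ * N, ?_, fun i => ?_, fun i => ?_⟩
  · rw [Matrix.mul_assoc, Matrix.mul_nonsing_inv_cancel_left _ _ hab, hN]
  · simp [N', Matrix.mul_apply, Fin.sum_univ_three, hM]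
  · change (M⁻¹ *ᵥ N.col 0) i = w i
    rw [hN0, Matrix.mulVec_mulVec, Matrix.nonsing_inv_mul _ hab, Matrix.one_mulVec]

theorem LaurentF2.exists_mul_eq_one {v w : Fin 3 → LaurentF2} (hvw : w ⬝ᵥ v = 1) :
    ∃ P Q : Matrix (Fin 3) (Fin 3) LaurentF2, P * Q = 1 ∧
      (∀ i, P 0 i = v i) ∧ ∀ i, Q i 0 = w i := by
  let e : LaurentF2 ≃+* LaurentPolynomial (LaurentPolynomial (ZMod 2)) :=
    AddMonoidAlgebra.curryRingEquiv
  obtain ⟨P, Q, hPQ, hP, hQ⟩ := LaurentPolynomial.exists_mul_eq_one (v := e ∘ v) (w := e ∘ w) (by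
    have := congrArg e hvw
    rw [map_one] at this
    rw [← this]
    exact (RingHom.map_dotProduct e.toRingHom w v).symm)
  refine ⟨P.map e.symm, Q.map e.symm, ?_, fun i => ?_, fun i => ?_⟩
  · have := congrArg e.symm.toRingHom.mapMatrix hPQ
    rw [map_mul, map_one] at this
    exact this
  · simp [hP]
  · simp [hQ]

theorem barR_barR (r : LaurentF2) : barR (barR r) = r := by
  ext n
  simp [barR]

theorem Lam_eq_submatrix_fromBlocks :
    Lam = (Matrix.fromBlocks 0 1 1 0).submatrix (finSumFinEquiv (m := 3) (n := 3)).symm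
      (finSumFinEquiv (m := 3) (n := 3)).symm := by
  ext1 i j
  obtain ⟨i, rfl⟩ := (finSumFinEquiv (m := 3) (n := 3)).surjective i
  obtain ⟨j, rfl⟩ := (finSumFinEquiv (m := 3) (n := 3)).surjective j
  rcases i with i | i <;> rcases j with j | j <;> fin_cases i <;> fin_cases j <;>
    simp [Lam] <;> decide

theorem finSix_vec_comp_finSumFinEquiv {R : Type*} (a b c d e f : R) :
    ![a, b, c, d, e, f] = Sum.elim ![a, b, c] ![d, e, f] ∘
      (finSumFinEquiv (m := 3) (n := 3)).symm := by
  rw [Equiv.eq_comp_symm]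
  ext i
  rcases i with i | i <;> fin_cases i <;> rfl

/-- Core of the SBB–BB Clifford correspondence: if the `X`-type vector `(x,0)` and the
`Z`-type vector `(0,z)` pair to `1`, there is an invertible symplectic matrix `U` over `R`
mapping them to the single-qubit Pauli pair `(1,0,0,0,0,0)`, `(0,0,0,1,0,0)`. -/
theorem symplectic_disentangling_exists
    (x₁ x₂ x₃ z₁ z₂ z₃ : LaurentF2)
    (hpair : barR x₁ * z₁ + barR x₂ * z₂ + barR x₃ * z₃ = 1) :
    ∃ U : Matrix (Fin 6) (Fin 6) LaurentF2,
      IsUnit U.det ∧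
      (U.map ⇑barR)ᵀ * Lam * U = Lam ∧
      U.mulVec ![x₁, x₂, x₃, 0, 0, 0] = ![1, 0, 0, 0, 0, 0] ∧
      U.mulVec ![0, 0, 0, z₁, z₂, z₃] = ![0, 0, 0, 1, 0, 0] := by
  obtain ⟨P, Q, hPQ, hP, hQ⟩ := LaurentF2.exists_mul_eq_one
    (v := ![barR z₁, barR z₂, barR z₃]) (w := ![x₁, x₂, x₃]) (by
      have := congrArg barR hpair
      simpa [barR_barR, dotProduct, Fin.sum_univ_three] using this)
  have hQP : Q * P = 1 := mul_eq_one_comm.1 hPQ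
  have hbar {M N : Matrix (Fin 3) (Fin 3) LaurentF2} (h : M * N = 1) :
      M.map barR * N.map barR = 1 := by
    rw [← Matrix.map_mul, h, Matrix.map_one _ (map_zero _) (map_one _)]
  have hbb (M : Matrix (Fin 3) (Fin 3) LaurentF2) : (M.map barR).map barR = M := by
    ext1 i j
    exact barR_barR _
  have hone : ![1, 0, 0] = (1 : Matrix (Fin 3) (Fin 3) LaurentF2).col 0 := by
    ext1 i
    fin_cases i <;> rfl
  have hPx : P *ᵥ ![x₁, x₂, x₃] = ![1, 0, 0] := by
    have : ![x₁, x₂, x₃] = Q.col 0 := funext fun i => (hQ i).symm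
    rw [this, hone, ← hPQ]
    rfl
  have hQz : (Q.map barR)ᵀ *ᵥ ![z₁, z₂, z₃] = ![1, 0, 0] := by
    have : ![z₁, z₂, z₃] = (P.map barR)ᵀ.col 0 := by
      ext1 i
      rw [Matrix.col_apply, Matrix.transpose_apply, Matrix.map_apply, hP]
      fin_cases i <;> exact (barR_barR _).symm
    rw [this, hone, ← Matrix.transpose_one, ← hbar hPQ, Matrix.transpose_mul]
    rfl
  have hzero : (![0, 0, 0] : Fin 3 → LaurentF2) = 0 := by
    ext1 i
    fin_cases i <;> rfl
  let B := Matrix.fromBlocks P 0 0 (Q.map barR)ᵀ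
  let e : Fin 3 ⊕ Fin 3 ≃ Fin 6 := finSumFinEquiv
  refine ⟨B.submatrix e.symm e.symm, ?_, ?_, ?_, ?_⟩
  · have hB : B * Matrix.fromBlocks Q 0 0 (P.map barR)ᵀ = 1 := by
      simp [B, Matrix.fromBlocks_multiply, hPQ, ← Matrix.transpose_mul, hbar hPQ]
    rw [Matrix.det_submatrix_equiv_self]
    exact IsUnit.of_mul_eq_one _ (by rw [← Matrix.det_mul, hB, Matrix.det_one])
  · rw [Lam_eq_submatrix_fromBlocks, ← Matrix.submatrix_map, Matrix.transpose_submatrix,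
      Matrix.submatrix_mul_equiv, Matrix.submatrix_mul_equiv]
    congr 1
    have hPQt : Pᵀ.map barR * Qᵀ.map barR = 1 :=
      hbar (by rw [← Matrix.transpose_mul, hQP, Matrix.transpose_one])
    simp [B, Matrix.fromBlocks_map, Matrix.fromBlocks_transpose, Matrix.fromBlocks_multiply,
      ← Matrix.transpose_map, hbb, hQP, hPQt]
  · rw [finSix_vec_comp_finSumFinEquiv, finSix_vec_comp_finSumFinEquiv 1,
      Matrix.submatrix_mulVec_equiv]
    congr 1
    simp [B, Function.comp_assoc, e, Matrix.fromBlocks_mulVec, hPx, hzero]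
  · rw [finSix_vec_comp_finSumFinEquiv, finSix_vec_comp_finSumFinEquiv 0 0 0 1,
      Matrix.submatrix_mulVec_equiv]
    congr 1
    simp [B, Function.comp_assoc, e, Matrix.fromBlocks_mulVec, hQz, hzero]
end
end
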